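/- Define f, h : ℝ → ℝ by f(t) = (1 − 13t)^(−3/26) and h(t) = (1 − 13t)^(5/26), and set a(t) = b(t) = c(t) = h(t). Then f(0) = a(0) = b(0) = c(0) = 1 and for every t < 1/13 the quadruple (f, a, b, c) satisfies all four equations of the Heisenberg Ricci-harmonic system: d/dt (f·a²) = −f³·(4a⁴(b⁴ + c⁴) − b⁴c⁴)/(2a²b⁴c⁴), d/dt (f·b²) = −f³·(4b⁴(a⁴ + c⁴) − a⁴c⁴)/(2a⁴b²c⁴), d/dt (f·c²) = −f³·(4c⁴(a⁴ + b⁴) − a⁴b⁴)/(2a⁴b⁴c²), and d/dt (a·b·c) = −f²·(3(abc)²(a² + b² + c²) + 2(a⁴b⁴ + a⁴c⁴ + b⁴c⁴))/(2a³b³c³). -/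

import Mathlib

open Real Topology Filter Set

theorem hasDerivAt_one_sub_mul_rpow {k t : ℝ} (p : ℝ) (ht : 0 < 1 - k * t) :
    HasDerivAt (fun s : ℝ => (1 - k * s) ^ p)
      (-(k * p) * (1 - k * t) ^ p / (1 - k * t)) t := by
  have hlin : HasDerivAt (fun s : ℝ => 1 - k * s) (-(k * 1)) t :=
    ((hasDerivAt_id t).const_mul k).const_sub 1
  convert hlin.rpow_const (p := p) (Or.inl ht.ne') using 1
  rw [Real.rpow_sub_one ht.ne']
  ring

/-- Explicit ancient solution of the Ricci-harmonic flow on the 7-dimensional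
Heisenberg group: with `f t = (1 - 13 t)^(-3/26)`, `a = b = c = h`,
`h t = (1 - 13 t)^(5/26)`, all four equations of the Heisenberg Ricci-harmonic
ODE system hold for `t < 1/13`. -/
theorem stmt_19 (f h a b c : ℝ → ℝ)
    (hf : ∀ t, f t = (1 - 13 * t) ^ ((-3 : ℝ) / 26))
    (hh : ∀ t, h t = (1 - 13 * t) ^ ((5 : ℝ) / 26))
    (hab : a = h) (hbb : b = h) (hcb : c = h) :
    f 0 = 1 ∧ a 0 = 1 ∧ b 0 = 1 ∧ c 0 = 1 ∧
      ∀ t : ℝ, t < 1 / 13 →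
        HasDerivAt (fun s => f s * (a s) ^ 2)
          (-(f t) ^ 3 * (4 * (a t) ^ 4 * ((b t) ^ 4 + (c t) ^ 4) -
              (b t) ^ 4 * (c t) ^ 4) /
            (2 * (a t) ^ 2 * (b t) ^ 4 * (c t) ^ 4)) t ∧
        HasDerivAt (fun s => f s * (b s) ^ 2)
          (-(f t) ^ 3 * (4 * (b t) ^ 4 * ((a t) ^ 4 + (c t) ^ 4) -
              (a t) ^ 4 * (c t) ^ 4) /
            (2 * (a t) ^ 4 * (b t) ^ 2 * (c t) ^ 4)) t ∧
        HasDerivAt (fun s => f s * (c s) ^ 2)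
          (-(f t) ^ 3 * (4 * (c t) ^ 4 * ((a t) ^ 4 + (b t) ^ 4) -
              (a t) ^ 4 * (b t) ^ 4) /
            (2 * (a t) ^ 4 * (b t) ^ 4 * (c t) ^ 2)) t ∧
        HasDerivAt (fun s => a s * b s * c s)
          (-(f t) ^ 2 * (3 * (a t * b t * c t) ^ 2 *
                ((a t) ^ 2 + (b t) ^ 2 + (c t) ^ 2) +
              2 * ((a t) ^ 4 * (b t) ^ 4 + (a t) ^ 4 * (c t) ^ 4 +
                (b t) ^ 4 * (c t) ^ 4)) /
            (2 * (a t) ^ 3 * (b t) ^ 3 * (c t) ^ 3)) t := by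
  subst hab hbb hcb
  refine ⟨by simp [hf], by simp [hh], by simp [hh], by simp [hh], fun t ht => ?_⟩
  have hu : 0 < 1 - 13 * t := by linarith
  have hF : HasDerivAt f (-(13 * (-3 / 26)) * f t / (1 - 13 * t)) t := by
    rw [hf t, funext hf]
    exact hasDerivAt_one_sub_mul_rpow _ hu
  have hH : HasDerivAt c (-(13 * (5 / 26)) * c t / (1 - 13 * t)) t := by
    rw [hh t, funext hh]
    exact hasDerivAt_one_sub_mul_rpow _ hu
  have hpos : 0 < c t := hh t ▸ Real.rpow_pos_of_pos hu _
  have hkey : f t ^ 2 * (1 - 13 * t) = c t ^ 4 := by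
    rw [hf, hh, ← Real.rpow_mul_natCast hu.le, ← Real.rpow_mul_natCast hu.le,
      ← Real.rpow_add_one hu.ne']
    norm_num
  have hFH := hF.mul (hH.pow 2)
  have hHHH := (hH.mul hH).mul hH
  simp only [Pi.mul_apply, Pi.pow_apply] at hFH hHHH
  generalize 1 - 13 * t = u at *
  refine ⟨hFH.congr_deriv ?_, hFH.congr_deriv ?_, hFH.congr_deriv ?_, hHHH.congr_deriv ?_⟩
  iterate 3
    field_simp
    linear_combination (182 * f t) * hkey
  field_simp
  linear_combination 390 * hkey
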